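/- arXiv:1511.04645 — 2 statements merged into one kernel-verified Lean document; each statement's English description precedes it below -/
import Mathlib

section
/- For every g ∈ G(Γ) and every natural number d, the d-tail of g contains at most dκ syllables. -/
open scoped ComplexOrder
open scoped commutatorElement

/-! ## Operator-norm notions -/

/-- `φ` is completely bounded (as a Herz–Schur multiplier) with cb-norm at most `C`:
there are a Hilbert space `H` and bounded maps `α β : G → H` with
`φ (h⁻¹ * g) = ⟪α g, β h⟫` and `(sup ‖α‖) * (sup ‖β‖) ≤ C`. -/
def HasCBNormBound {G : Type} [Group G] (φ : G → ℂ) (C : ℝ) : Prop :=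
  ∃ (H : Type) (_ : NormedAddCommGroup H) (_ : InnerProductSpace ℂ H)
    (α β : G → H) (Ca Cb : ℝ),
      (∀ g, ‖α g‖ ≤ Ca) ∧ (∀ h, ‖β h‖ ≤ Cb) ∧ Ca * Cb ≤ C ∧
      ∀ g h : G, φ (h⁻¹ * g) = (inner ℂ (α g) (β h) : ℂ)

/-- A kernel `φ : G × G → ℂ` is completely bounded with cb-norm at most `C`. -/
def HasCBKernelBound {G : Type} (φ : G → G → ℂ) (C : ℝ) : Prop :=
  ∃ (H : Type) (_ : NormedAddCommGroup H) (_ : InnerProductSpace ℂ H)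
    (α β : G → H) (Ca Cb : ℝ),
      (∀ g, ‖α g‖ ≤ Ca) ∧ (∀ h, ‖β h‖ ≤ Cb) ∧ Ca * Cb ≤ C ∧
      ∀ g h : G, φ g h = (inner ℂ (α g) (β h) : ℂ)

/-- A function `φ : G → ℂ` is positive definite. -/
def IsPosDefFn {G : Type} [Group G] (φ : G → ℂ) : Prop :=
  ∀ (n : ℕ) (c : Fin n → ℂ) (x : Fin n → G),
    0 ≤ ∑ i, ∑ j, c i * (starRingEnd ℂ) (c j) * φ ((x j)⁻¹ * x i)

/-- A kernel `Ψ : G × G → ℂ` is positive definite. -/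
def IsPosDefKernel {X : Type} (Ψ : X → X → ℂ) : Prop :=
  ∀ (n : ℕ) (c : Fin n → ℂ) (x : Fin n → X),
    0 ≤ ∑ i, ∑ j, c i * (starRingEnd ℂ) (c j) * Ψ (x i) (x j)

/-- A (discrete) group is amenable iff it admits an approximate identity of finitely
supported positive definite functions; we use this characterization. -/
def AmenablePD (G : Type) [Group G] : Prop :=
  ∀ (S : Finset G) (ε : ℝ), 0 < ε →
    ∃ φ : G → ℂ, (Function.support φ).Finite ∧ IsPosDefFn φ ∧ ∀ g ∈ S, ‖φ g - 1‖ < ε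

/-- A group is weakly amenable with Cowling–Haagerup constant 1: there is a net of finitely
supported completely bounded functions converging to 1 pointwise with cb-norms with
limsup at most 1. -/
def WeaklyAmenableCH1 (G : Type) [Group G] : Prop :=
  ∀ (S : Finset G) (ε : ℝ), 0 < ε →
    ∃ φ : G → ℂ, (Function.support φ).Finite ∧ HasCBNormBound φ (1 + ε) ∧
      ∀ g ∈ S, ‖φ g - 1‖ < ε

/-! ## Graph products -/

section GraphProd

variable {V : Type} (Γ : SimpleGraph V) (G : V → Type) [∀ v, Group (G v)]

/-- The commutators `[G_v, G_w]` over the edges of `Γ`. -/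
def commRels : Set (Monoid.CoprodI G) :=
  {x | ∃ (v w : V) (a : G v) (b : G w), Γ.Adj v w ∧
    x = ⁅Monoid.CoprodI.of a, Monoid.CoprodI.of b⁆}

/-- The graph product of the groups `G v` over the graph `Γ`. -/
abbrev GraphProduct :=
  Monoid.CoprodI G ⧸ Subgroup.normalClosure (commRels Γ G)

/-- The image in the graph product of a syllable, i.e. an element of a vertex group. -/
def ofSyl (s : (v : V) × G v) : GraphProduct Γ G :=
  QuotientGroup.mk (Monoid.CoprodI.of s.2)

/-- The element of the graph product represented by a formal word of syllables. -/
def wordProd (w : List ((v : V) × G v)) : GraphProduct Γ G :=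
  (w.map (ofSyl Γ G)).prod

/-- `w` is a formal word of nontrivial syllables representing `g`. -/
def IsWordOf (w : List ((v : V) × G v)) (g : GraphProduct Γ G) : Prop :=
  (∀ s ∈ w, s.2 ≠ 1) ∧ wordProd Γ G w = g

/-- The reduced word length `|g|_r`. -/
noncomputable def redLength (g : GraphProduct Γ G) : ℕ :=
  sInf {n | ∃ w, IsWordOf Γ G w g ∧ w.length = n}

/-- `w` is a reduced word representing `g` : a representing word of nontrivial syllables
of minimal syllable length. -/
def IsReducedWordOf (w : List ((v : V) × G v)) (g : GraphProduct Γ G) : Prop :=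
  IsWordOf Γ G w g ∧ ∀ w', IsWordOf Γ G w' g → w.length ≤ w'.length

/-- `κ`: the maximal number of mutually adjacent vertices of `Γ`. -/
noncomputable def kappa : ℕ :=
  sSup {n | ∃ s : Finset V, Γ.IsNClique n s}

/-- The `d`-tail of `g`: syllables appearing among the last `d` syllables of some reduced
word representing `g`. -/
def dTail (g : GraphProduct Γ G) (d : ℕ) : Set ((v : V) × G v) :=
  {s | ∃ w, IsReducedWordOf Γ G w g ∧ s ∈ w.drop (w.length - d)}

/-- `g` begins with `G_v`. -/
def BeginsWith (g : GraphProduct Γ G) (v : V) : Prop :=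
  ∃ w s, IsReducedWordOf Γ G w g ∧ w.head? = some s ∧ s.1 = v

/-- `g` ends with `G(lk(v))`: some reduced word for `g` has last syllable in a vertex
group adjacent to `v`. -/
def EndsWithLink (g : GraphProduct Γ G) (v : V) : Prop :=
  ∃ w s, IsReducedWordOf Γ G w g ∧ w.getLast? = some s ∧ Γ.Adj s.1 v

/-- The half-space `𝔸_v` of elements beginning with `G_v`. -/
noncomputable def halfSpace (v : V) : Set (GraphProduct Γ G) :=
  {g | ∃ gv : G v, redLength Γ G (ofSyl Γ G ⟨v, gv⟩ * g) < redLength Γ G g}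

/-- Left translate `k • s` of a subset of the graph product. -/
def wallTrans (k : GraphProduct Γ G) (s : Set (GraphProduct Γ G)) : Set (GraphProduct Γ G) :=
  (fun x => k * x) '' s

/-- Two walls (given by their preferred half-spaces) cross if all four intersections of
half-spaces are nonempty. -/
def Cross {X : Type} (s t : Set X) : Prop :=
  (s ∩ t).Nonempty ∧ (s ∩ tᶜ).Nonempty ∧ (sᶜ ∩ t).Nonempty ∧ (sᶜ ∩ tᶜ).Nonempty

/-- The set of walls `𝕎 = {k𝔸_v}`. -/
noncomputable def Walls : Set (Set (GraphProduct Γ G)) :=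
  {s | ∃ (k : GraphProduct Γ G) (v : V), s = wallTrans Γ G k (halfSpace Γ G v)}

/-- The wall (pseudo)distance: the number of walls separating `x` and `y`. -/
noncomputable def wallDist (x y : GraphProduct Γ G) : ℕ :=
  {s | s ∈ Walls Γ G ∧ Xor' (x ∈ s) (y ∈ s)}.ncard

end GraphProd


/-- The image in the free product `A ∗ B` of a syllable. -/
def sylEmb (A B : Type) [Group A] [Group B] : A ⊕ B → Monoid.Coprod A B :=
  Sum.elim (fun a => Monoid.Coprod.inl a) (fun b => Monoid.Coprod.inr b)


section Aux

set_option linter.unusedSectionVars false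
set_option linter.unusedSimpArgs false

open Classical

variable {V : Type} (Γ : SimpleGraph V) (G : V → Type) [∀ v, Group (G v)]

/-- projection of a word to two vertices -/
noncomputable def gpProj (u v : V) (w : List ((v : V) × G v)) : List ((v : V) × G v) :=
  w.filter (fun s => decide (s.1 = u ∨ s.1 = v))

/-- shuffle equivalence, through projections -/
def gpEq (w w' : List ((v : V) × G v)) : Prop :=
  ∀ u v, ¬ Γ.Adj u v → gpProj G u v w = gpProj G u v w'

/-- the word starts with the syllable `b` of `G v` up to shuffles -/
def gpH (v : V) (w : List ((v : V) × G v)) (b : G v) : Prop :=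
  ∀ u, ¬ Γ.Adj u v → (gpProj G u v w).head? = some ⟨v, b⟩

/-- the word does not start with `v` -/
def gpNS (v : V) (w : List ((v : V) × G v)) : Prop := ∀ b, ¬ gpH Γ G v w b

/-- combinatorially reduced words -/
def gpRed : List ((v : V) × G v) → Prop
  | [] => True
  | s :: l => s.2 ≠ 1 ∧ gpNS Γ G s.1 l ∧ gpRed l

/-- prepend a possibly trivial syllable -/
noncomputable def gpCons (v : V) (b : G v) (w : List ((v : V) × G v)) : List ((v : V) × G v) :=
  if b = 1 then w else ⟨v, b⟩ :: w

variable {Γ G}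

lemma gpEq.refl (w : List ((v : V) × G v)) : gpEq Γ G w w := fun _ _ _ => rfl
lemma gpEq.symm {w w' : List ((v : V) × G v)} (h : gpEq Γ G w w') : gpEq Γ G w' w :=
  fun u v a => (h u v a).symm
lemma gpEq.trans {w w' w'' : List ((v : V) × G v)} (h : gpEq Γ G w w') (h' : gpEq Γ G w' w'') :
    gpEq Γ G w w'' := fun u v a => (h u v a).trans (h' u v a)

lemma gpEq.cons {w w' : List ((v : V) × G v)} (s : (v : V) × G v) (h : gpEq Γ G w w') :
    gpEq Γ G (s :: w) (s :: w') := by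
  intro u v a
  have := h u v a
  simp only [gpProj, List.filter_cons] at this ⊢
  rw [this]

lemma gpEq.of_cons {w w' : List ((v : V) × G v)} (s : (v : V) × G v)
    (h : gpEq Γ G (s :: w) (s :: w')) : gpEq Γ G w w' := by
  intro u v a
  have := h u v a
  simp only [gpProj, List.filter_cons] at this ⊢
  split_ifs at this
  · exact (List.cons.inj this).2
  · exact this

lemma gpEq.gpCons {w w' : List ((v : V) × G v)} (v : V) (b : G v) (h : gpEq Γ G w w') :
    gpEq Γ G (gpCons G v b w) (gpCons G v b w') := by
  unfold _root_.gpCons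
  split_ifs
  · exact h
  · exact h.cons _

lemma gpEq_swap (s t : (v : V) × G v) (h : Γ.Adj s.1 t.1) (w : List ((v : V) × G v)) :
    gpEq Γ G (s :: t :: w) (t :: s :: w) := by
  intro u v a
  simp only [gpProj, List.filter_cons]
  have h1 := h.ne
  have h2 := h.symm
  by_cases hs : s.1 = u ∨ s.1 = v <;> by_cases ht : t.1 = u ∨ t.1 = v <;> simp [hs, ht]
  exfalso
  rcases hs with hs | hs <;> rcases ht with ht | ht <;> simp_all

lemma gpEq_cons_gpCons (s : (v : V) × G v) {v : V} (b : G v) (h : Γ.Adj s.1 v)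
    (w : List ((v : V) × G v)) :
    gpEq Γ G (s :: gpCons G v b w) (gpCons G v b (s :: w)) := by
  unfold gpCons
  split_ifs
  · exact gpEq.refl _
  · exact gpEq_swap s ⟨v, b⟩ h w

lemma gpEq_gpCons_gpCons {u v : V} (c : G u) (b : G v) (h : Γ.Adj u v)
    (w : List ((v : V) × G v)) :
    gpEq Γ G (gpCons G u c (gpCons G v b w)) (gpCons G v b (gpCons G u c w)) := by
  by_cases hc : c = 1
  · simp only [gpCons, hc, if_true]; exact gpEq.refl _
  · have : ∀ l, gpCons G u c l = ⟨u, c⟩ :: l := fun l => by simp [gpCons, hc]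
    rw [this, this]
    exact gpEq_cons_gpCons ⟨u, c⟩ b h w

lemma gpH.congr {v : V} {w w' : List ((v : V) × G v)} (h : gpEq Γ G w w') {b : G v}
    (hb : gpH Γ G v w b) : gpH Γ G v w' b := fun u a => by
  rw [← h u v a]; exact hb u a

lemma gpNS.congr {v : V} {w w' : List ((v : V) × G v)} (h : gpEq Γ G w w')
    (hb : gpNS Γ G v w) : gpNS Γ G v w' := fun b hh => hb b (hh.congr h.symm)

lemma gpH_self (v : V) (b : G v) (w : List ((v : V) × G v)) : gpH Γ G v (⟨v, b⟩ :: w) b := by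
  intro u a
  simp [gpProj, List.filter_cons]

lemma gpH_unique {v : V} {b c : G v} {w : List ((v : V) × G v)} (h : gpH Γ G v w b)
    (h' : gpH Γ G v w c) : b = c := by
  have h1 := h v (Γ.irrefl)
  rw [h' v (Γ.irrefl)] at h1
  simpa using h1.symm

lemma gpH_cons_iff {v : V} {b : G v} (s : (v : V) × G v) (h : Γ.Adj s.1 v)
    {w : List ((v : V) × G v)} : gpH Γ G v (s :: w) b ↔ gpH Γ G v w b := by
  have key : ∀ u, ¬ Γ.Adj u v → gpProj G u v (s :: w) = gpProj G u v w := by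
    intro u a
    have h1 := h.ne
    have h2 : s.1 ≠ u := by rintro rfl; exact a h
    simp [gpProj, List.filter_cons, h1, h2]
  constructor
  · intro hh u a
    rw [← key u a]; exact hh u a
  · intro hh u a
    rw [key u a]; exact hh u a

lemma gpNS_cons_iff {v : V} (s : (v : V) × G v) (h : Γ.Adj s.1 v)
    {w : List ((v : V) × G v)} : gpNS Γ G v (s :: w) ↔ gpNS Γ G v w :=
  forall_congr' fun _ => not_congr (gpH_cons_iff s h)

lemma gpNS_gpCons_iff {u v : V} (c : G u) (h : Γ.Adj u v)
    {w : List ((v : V) × G v)} : gpNS Γ G v (gpCons G u c w) ↔ gpNS Γ G v w := by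
  unfold gpCons
  split_ifs
  · rfl
  · exact gpNS_cons_iff ⟨u, c⟩ h

lemma gpNS_cons_of_not {v : V} (s : (v : V) × G v) (h : ¬ Γ.Adj s.1 v) (h1 : s.1 ≠ v)
    (w : List ((v : V) × G v)) : gpNS Γ G v (s :: w) := by
  intro b hb
  have := hb s.1 h
  simp [gpProj, List.filter_cons] at this
  apply h1
  rw [this]

lemma gpRed_gpCons {v : V} (b : G v) {r : List ((v : V) × G v)} (hr : gpRed Γ G r)
    (hn : gpNS Γ G v r) : gpRed Γ G (gpCons G v b r) := by
  unfold gpCons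
  split_ifs with h
  · exact hr
  · exact ⟨h, hn, hr⟩

lemma gp_unique {v : V} {b c : G v} {r r' : List ((v : V) × G v)} (hr : gpNS Γ G v r)
    (hr' : gpNS Γ G v r') (h : gpEq Γ G (gpCons G v b r) (gpCons G v c r')) :
    b = c ∧ gpEq Γ G r r' := by
  unfold gpCons at h
  split_ifs at h with hb hc hc
  · exact ⟨hb.trans hc.symm, h⟩
  · exact absurd ((gpH_self v c r').congr h.symm) (hr c)
  · exact absurd ((gpH_self v b r).congr h) (hr' b)
  · have := gpH_unique ((gpH_self v b r).congr h) (gpH_self v c r')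
    subst this
    exact ⟨rfl, h.of_cons⟩

lemma ofSyl_comm {s t : (v : V) × G v} (h : Γ.Adj s.1 t.1) :
    ofSyl Γ G s * ofSyl Γ G t = ofSyl Γ G t * ofSyl Γ G s := by
  rw [← commutatorElement_eq_one_iff_mul_comm]
  have : (⁅ofSyl Γ G s, ofSyl Γ G t⁆ : GraphProduct Γ G) =
      QuotientGroup.mk (⁅Monoid.CoprodI.of s.2, Monoid.CoprodI.of t.2⁆) := rfl
  rw [this, QuotientGroup.eq_one_iff]
  exact Subgroup.subset_normalClosure ⟨s.1, t.1, s.2, t.2, h, rfl⟩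

lemma wordProd_cons (s : (v : V) × G v) (w : List ((v : V) × G v)) :
    wordProd Γ G (s :: w) = ofSyl Γ G s * wordProd Γ G w := by
  simp [wordProd]

lemma ofSyl_one (v : V) : ofSyl Γ G ⟨v, 1⟩ = 1 := by
  simp [ofSyl]

lemma ofSyl_mul (v : V) (a b : G v) : ofSyl Γ G ⟨v, a * b⟩ = ofSyl Γ G ⟨v, a⟩ * ofSyl Γ G ⟨v, b⟩ := by
  simp [ofSyl]

lemma wordProd_gpCons (v : V) (b : G v) (w : List ((v : V) × G v)) :
    wordProd Γ G (gpCons G v b w) = ofSyl Γ G ⟨v, b⟩ * wordProd Γ G w := by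
  unfold gpCons
  split_ifs with h
  · rw [h, ofSyl_one, one_mul]
  · exact wordProd_cons _ _

lemma gp_exists (v : V) (w : List ((v : V) × G v)) (hw : gpRed Γ G w) :
    ∃ (b : G v) (r : List ((v : V) × G v)), gpRed Γ G r ∧ gpNS Γ G v r ∧
      gpEq Γ G w (gpCons G v b r) ∧ wordProd Γ G w = wordProd Γ G (gpCons G v b r) ∧
      w.length = (gpCons G v b r).length := by
  induction w with
  | nil =>
    refine ⟨1, [], trivial, ?_, ?_, ?_, ?_⟩
    · intro b hb
      have := hb v Γ.irrefl
      simp [gpProj] at this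
    all_goals simp [gpCons, gpEq.refl]
  | cons s l ih =>
    obtain ⟨h1, h2, h3⟩ := hw
    by_cases hv : s.1 = v
    · subst hv
      refine ⟨s.2, l, h3, h2, ?_, ?_, ?_⟩ <;> simp [gpCons, h1, gpEq.refl]
    by_cases ha : Γ.Adj s.1 v
    · obtain ⟨b, r, q1, q2, q3, q4, q5⟩ := ih h3
      refine ⟨b, s :: r, ⟨h1, ?_, q1⟩, (gpNS_cons_iff s ha).2 q2,
        (q3.cons s).trans (gpEq_cons_gpCons s b ha r), ?_, ?_⟩
      · exact (gpNS_gpCons_iff b ha.symm).1 (h2.congr q3)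
      · rw [wordProd_cons, q4, wordProd_gpCons, wordProd_gpCons, wordProd_cons, ← mul_assoc,
          ← mul_assoc, ofSyl_comm (t := ⟨v, b⟩) ha]
      · simp only [List.length_cons, q5]
        unfold gpCons
        split_ifs <;> simp
    · refine ⟨1, s :: l, ⟨h1, h2, h3⟩, gpNS_cons_of_not s ha hv l, ?_, ?_, ?_⟩ <;>
        simp [gpCons, gpEq.refl]

variable (Γ G)

/-- shuffle equivalence on reduced words -/
def gpSetoid : Setoid {w : List ((v : V) × G v) // gpRed Γ G w} where
  r a b := gpEq Γ G a.1 b.1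
  iseqv := ⟨fun a => gpEq.refl a.1, fun h => gpEq.symm h, fun h h' => gpEq.trans h h'⟩

/-- classes of reduced words -/
def gpX : Type := Quotient (gpSetoid Γ G)

variable {Γ G}

/-- the class of a reduced word -/
def gpMk (w : List ((v : V) × G v)) (hw : gpRed Γ G w) : gpX Γ G :=
  Quotient.mk (gpSetoid Γ G) ⟨w, hw⟩

lemma gpMk_eq {w w' : List ((v : V) × G v)} {hw : gpRed Γ G w} {hw' : gpRed Γ G w'} :
    gpMk w hw = gpMk w' hw' ↔ gpEq Γ G w w' :=
  ⟨fun h => Quotient.exact (s := gpSetoid Γ G) h, fun h => Quotient.sound (s := gpSetoid Γ G) h⟩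

lemma gpX_exists (v : V) (x : gpX Γ G) :
    ∃ (b : G v) (r : List ((v : V) × G v)) (hr : gpRed Γ G r) (hn : gpNS Γ G v r),
      x = gpMk (gpCons G v b r) (gpRed_gpCons b hr hn) := by
  induction x using Quotient.inductionOn with
  | h w =>
    obtain ⟨b, r, q1, q2, q3, -, -⟩ := gp_exists v w.1 w.2
    exact ⟨b, r, q1, q2, gpMk_eq.2 q3⟩

/-- the action of a vertex group -/
noncomputable def gpAct (v : V) (a : G v) (x : gpX Γ G) : gpX Γ G :=
  gpMk (gpCons G v (a * (gpX_exists v x).choose) (gpX_exists v x).choose_spec.choose)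
    (gpRed_gpCons _ (gpX_exists v x).choose_spec.choose_spec.choose
      (gpX_exists v x).choose_spec.choose_spec.choose_spec.choose)

lemma gpAct_mk (v : V) (a b : G v) (r : List ((v : V) × G v)) (hr : gpRed Γ G r)
    (hn : gpNS Γ G v r) :
    gpAct v a (gpMk (gpCons G v b r) (gpRed_gpCons b hr hn)) =
      gpMk (gpCons G v (a * b) r) (gpRed_gpCons _ hr hn) := by
  set x := gpMk (gpCons G v b r) (gpRed_gpCons b hr hn) with hx
  have h := (gpX_exists v x).choose_spec.choose_spec.choose_spec.choose_spec
  rw [hx, gpMk_eq] at h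
  obtain ⟨h1, h2⟩ := gp_unique hn (gpX_exists v x).choose_spec.choose_spec.choose_spec.choose h
  unfold gpAct
  rw [gpMk_eq, h1]
  exact h2.symm.gpCons _ _

/-- the action as a hom -/
noncomputable def gpHom (v : V) : G v →* Function.End (gpX Γ G) where
  toFun a := gpAct v a
  map_one' := by
    funext x
    obtain ⟨b, r, hr, hn, rfl⟩ := gpX_exists v x
    change gpAct v 1 _ = gpMk _ _
    rw [gpAct_mk v 1 b r hr hn, gpMk_eq, one_mul]
    exact gpEq.refl _
  map_mul' a a' := by
    funext x
    obtain ⟨b, r, hr, hn, rfl⟩ := gpX_exists v x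
    change _ = gpAct v a (gpAct v a' _)
    rw [gpAct_mk v _ b r hr hn, gpAct_mk v _ b r hr hn, gpAct_mk v _ _ r hr hn, gpMk_eq, mul_assoc]
    exact gpEq.refl _

lemma gpAct_comm_aux {u v : V} (h : Γ.Adj u v) (c c' : G u) (b b' : G v)
    (r : List ((v : V) × G v)) (hr : gpRed Γ G r) (hu : gpNS Γ G u r) (hv : gpNS Γ G v r) 
    (hh : gpRed Γ G (gpCons G v b (gpCons G u c r)))
    (hh' : gpRed Γ G (gpCons G v (b' * b) (gpCons G u (c' * c) r))) :
    gpAct u c' (gpAct v b' (gpMk (gpCons G v b (gpCons G u c r)) hh)) =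
      gpMk (gpCons G v (b' * b) (gpCons G u (c' * c) r)) hh' := by
  rw [gpAct_mk v b' b _ (gpRed_gpCons c hr hu) ((gpNS_gpCons_iff c h).2 hv)]
  have e : ∀ d : G v, ∀ hd, gpMk (gpCons G v d (gpCons G u c r)) hd =
    gpMk (gpCons G u c (gpCons G v d r)) (gpRed_gpCons c (gpRed_gpCons d hr hv)
      ((gpNS_gpCons_iff d h.symm).2 hu)) := fun d hd => gpMk_eq.2 (gpEq_gpCons_gpCons d c h.symm r)
  rw [e, gpAct_mk u c' c _ (gpRed_gpCons _ hr hv) ((gpNS_gpCons_iff _ h.symm).2 hu), gpMk_eq]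
  exact gpEq_gpCons_gpCons _ _ h _

lemma gpAct_comm {u v : V} (h : Γ.Adj u v) (c : G u) (b : G v) (x : gpX Γ G) :
    gpAct u c (gpAct v b x) = gpAct v b (gpAct u c x) := by
  obtain ⟨b0, r0, hr0, hn0, rfl⟩ := gpX_exists v x
  obtain ⟨c0, r, q1, q2, q3, -, -⟩ := gp_exists u r0 hr0
  have hv : gpNS Γ G v r := (gpNS_gpCons_iff c0 h).1 (hn0.congr q3)
  have r1 : ∀ d e, gpRed Γ G (gpCons G v d (gpCons G u e r)) := fun d e =>
    gpRed_gpCons d (gpRed_gpCons e q1 q2) ((gpNS_gpCons_iff e h).2 hv)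
  have r2 : ∀ d e, gpRed Γ G (gpCons G u e (gpCons G v d r)) := fun d e =>
    gpRed_gpCons e (gpRed_gpCons d q1 hv) ((gpNS_gpCons_iff d h.symm).2 q2)
  have e1 : gpMk (gpCons G v b0 r0) (gpRed_gpCons b0 hr0 hn0) =
    gpMk (gpCons G v b0 (gpCons G u c0 r)) (r1 _ _) := gpMk_eq.2 (q3.gpCons v b0)
  have e2 : gpMk (gpCons G v b0 (gpCons G u c0 r)) (r1 _ _) =
    gpMk (gpCons G u c0 (gpCons G v b0 r)) (r2 _ _) :=
      gpMk_eq.2 (gpEq_gpCons_gpCons _ _ h.symm _)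
  rw [e1, gpAct_comm_aux h c0 c b0 b r q1 q2 hv _ (r1 _ _), e2,
    gpAct_comm_aux h.symm b0 b c0 c r q1 hv q2 _ (r2 _ _), gpMk_eq]
  exact gpEq_gpCons_gpCons _ _ h.symm _

variable (Γ G)

/-- the hom from the free product -/
noncomputable def gpHomFree : Monoid.CoprodI G →* Function.End (gpX Γ G) :=
  Monoid.CoprodI.lift (fun v => gpHom v)

lemma gpHomFree_ker : Subgroup.normalClosure (commRels Γ G) ≤ (gpHomFree Γ G).ker := by
  apply Subgroup.normalClosure_le_normal
  rintro _ ⟨v, w, a, b, h, rfl⟩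
  change gpHomFree Γ G _ = 1
  have hc : gpHomFree Γ G (Monoid.CoprodI.of a * Monoid.CoprodI.of b) =
      gpHomFree Γ G (Monoid.CoprodI.of b * Monoid.CoprodI.of a) := by
    rw [map_mul, map_mul]
    simp only [gpHomFree, Monoid.CoprodI.lift_of]
    funext x
    exact gpAct_comm h a b x
  rw [commutatorElement_def, map_mul, map_mul, hc, ← map_mul, ← map_mul]
  simp

/-- the hom from the graph product -/
noncomputable def gpHomG : GraphProduct Γ G →* Function.End (gpX Γ G) :=
  QuotientGroup.lift _ (gpHomFree Γ G) (gpHomFree_ker Γ G)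

lemma gpHomG_ofSyl (s : (v : V) × G v) (x : gpX Γ G) :
    gpHomG Γ G (ofSyl Γ G s) x = gpAct s.1 s.2 x := by
  have : gpHomG Γ G (ofSyl Γ G s) = gpHom s.1 s.2 := by
    simp [gpHomG, ofSyl, gpHomFree]
  rw [this]; rfl

lemma gpHomG_word (w : List ((v : V) × G v)) (hw : gpRed Γ G w) :
    gpHomG Γ G (wordProd Γ G w) (gpMk [] trivial) = gpMk w hw := by
  induction w with
  | nil =>
    simp only [wordProd, List.map_nil, List.prod_nil, map_one]
    rfl
  | cons s l ih =>
    have h := ih hw.2.2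
    rw [wordProd_cons, map_mul]
    change gpHomG Γ G (ofSyl Γ G s) (gpHomG Γ G (wordProd Γ G l) _) = _
    rw [h, gpHomG_ofSyl]
    have e : gpMk l hw.2.2 = gpMk (gpCons G s.1 1 l) (gpRed_gpCons 1 hw.2.2 hw.2.1) := by
      rw [gpMk_eq]; simp [gpCons, gpEq.refl]
    rw [e, gpAct_mk _ _ _ _ hw.2.2 hw.2.1, gpMk_eq]
    simp [gpCons, hw.1, gpEq.refl]

lemma gpEq_of_prod {w w' : List ((v : V) × G v)} (hw : gpRed Γ G w) (hw' : gpRed Γ G w')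
    (h : wordProd Γ G w = wordProd Γ G w') : gpEq Γ G w w' := by
  have h1 := gpHomG_word Γ G w hw
  rw [h, gpHomG_word Γ G w' hw', gpMk_eq] at h1
  exact h1.symm

lemma gp_nontriv {w : List ((v : V) × G v)} (hw : gpRed Γ G w) : ∀ s ∈ w, s.2 ≠ 1 := by
  induction w with
  | nil => simp
  | cons s l ih =>
    intro t ht
    rcases List.mem_cons.1 ht with rfl | ht
    · exact hw.1
    · exact ih hw.2.2 t ht

lemma gp_shorten (w : List ((v : V) × G v)) (hn : ∀ s ∈ w, s.2 ≠ 1) (hw : ¬ gpRed Γ G w) :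
    ∃ w' : List ((v : V) × G v), (∀ s ∈ w', s.2 ≠ 1) ∧ wordProd Γ G w' = wordProd Γ G w ∧
      w'.length < w.length := by
  induction w with
  | nil => exact absurd trivial hw
  | cons s l ih =>
    by_cases hl : gpRed Γ G l
    · have hns : ¬ gpNS Γ G s.1 l := fun h => hw ⟨hn s (by simp), h, hl⟩
      obtain ⟨b, r, q1, q2, q3, q4, q5⟩ := gp_exists s.1 l hl
      have hb : b ≠ 1 := by
        rintro rfl
        apply hns
        simp only [gpCons, if_true] at q3
        exact q2.congr q3.symm
      refine ⟨gpCons G s.1 (s.2 * b) r, gp_nontriv Γ G (gpRed_gpCons _ q1 q2), ?_, ?_⟩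
      · rw [wordProd_gpCons, wordProd_cons, q4, wordProd_gpCons, ofSyl_mul, mul_assoc]
      · simp only [gpCons, hb, if_false, List.length_cons] at q5
        unfold gpCons
        split_ifs <;> simp [q5]
    · obtain ⟨w', h1, h2, h3⟩ := ih (fun t ht => hn t (by simp [ht])) hl
      refine ⟨s :: w', ?_, ?_, ?_⟩
      · intro t ht
        rcases List.mem_cons.1 ht with rfl | ht
        · exact hn _ (by simp)
        · exact h1 t ht
      · rw [wordProd_cons, wordProd_cons, h2]
      · simpa using h3

lemma gpRed_of_reduced {w : List ((v : V) × G v)} {g : GraphProduct Γ G}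
    (h : IsReducedWordOf Γ G w g) : gpRed Γ G w := by
  by_contra hw
  obtain ⟨w', h1, h2, h3⟩ := gp_shorten Γ G w h.1.1 hw
  exact absurd (h.2 w' ⟨h1, h2.trans h.1.2⟩) (by omega)

lemma gpEq_of_reduced {w w' : List ((v : V) × G v)} {g : GraphProduct Γ G}
    (h : IsReducedWordOf Γ G w g) (h' : IsReducedWordOf Γ G w' g) : gpEq Γ G w w' :=
  gpEq_of_prod Γ G (gpRed_of_reduced Γ G h) (gpRed_of_reduced Γ G h') (h.1.2.trans h'.1.2.symm)

lemma gp_list_aux {α : Type} {p q x y : List α} {s t : α} (hst : s ≠ t)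
    (h : p ++ s :: x = q ++ t :: y) : t ∈ x ∨ s ∈ y := by
  rcases List.append_eq_append_iff.1 h with ⟨a, h1, h2⟩ | ⟨a, h1, h2⟩
  · cases a with
    | nil => simp at h2; exact absurd h2.1 hst
    | cons c a => simp at h2; left; simp [h2.2]
  · cases a with
    | nil => simp at h2; exact absurd h2.1.symm hst
    | cons c a => simp at h2; right; simp [h2.2]

lemma gp_tail_split {g : GraphProduct Γ G} {d : ℕ} {s : (v : V) × G v}
    (h : s ∈ dTail Γ G g (d + 1)) (h' : s ∉ dTail Γ G g d) :
    ∃ u x, IsReducedWordOf Γ G (u ++ s :: x) g ∧ x.length = d := by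
  obtain ⟨w, hw, hs⟩ := h
  have h2 : s ∉ w.drop (w.length - d) := fun h => h' ⟨w, hw, h⟩
  have hlen : d < w.length := by
    by_contra hc
    apply h2
    have e : w.length - d = w.length - (d + 1) := by omega
    rw [e]; exact hs
  have hlt : w.length - (d + 1) < w.length := by omega
  rw [List.drop_eq_getElem_cons hlt] at hs
  have e : w.length - (d + 1) + 1 = w.length - d := by omega
  rw [e] at hs
  rcases List.mem_cons.1 hs with hs | hs
  · refine ⟨w.take (w.length - (d + 1)), w.drop (w.length - d), ?_, ?_⟩
    · have : w.take (w.length - (d + 1)) ++ s :: w.drop (w.length - d) = w := by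
        rw [hs, ← e, ← List.drop_eq_getElem_cons hlt, List.take_append_drop]
      rw [this]; exact hw
    · simp; omega
  · exact absurd hs h2

lemma gp_tail_adj {g : GraphProduct Γ G} {d : ℕ} {s t : (v : V) × G v}
    (hs : s ∈ dTail Γ G g (d + 1) \ dTail Γ G g d)
    (ht : t ∈ dTail Γ G g (d + 1) \ dTail Γ G g d) (hst : s ≠ t) : Γ.Adj s.1 t.1 := by
  by_contra ha
  obtain ⟨p, x, hw, hx⟩ := gp_tail_split Γ G hs.1 hs.2
  obtain ⟨q, y, hw', hy⟩ := gp_tail_split Γ G ht.1 ht.2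
  have h := gpEq_of_reduced Γ G hw hw' s.1 t.1 ha
  simp [gpProj, List.filter_append, List.filter_cons] at h
  rcases gp_list_aux hst h with h | h
  · apply ht.2
    refine ⟨_, hw, ?_⟩
    have e : (p ++ s :: x).length - d = (p ++ [s]).length := by simp; omega
    have e2 : p ++ s :: x = (p ++ [s]) ++ x := by simp
    rw [e, e2, List.drop_left]
    exact (List.mem_filter.1 h).1
  · apply hs.2
    refine ⟨_, hw', ?_⟩
    have e : (q ++ t :: y).length - d = (q ++ [t]).length := by simp; omega
    have e2 : q ++ t :: y = (q ++ [t]) ++ y := by simp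
    rw [e, e2, List.drop_left]
    exact (List.mem_filter.1 h).1

lemma gp_step [Fintype V] (A : Set ((v : V) × G v))
    (hA : ∀ s ∈ A, ∀ t ∈ A, s ≠ t → Γ.Adj s.1 t.1) : A.Finite ∧ A.ncard ≤ kappa Γ := by
  have hinj : Set.InjOn Sigma.fst A := by
    intro s hs t ht h
    by_contra hst
    exact (hA s hs t ht hst).ne h
  refine ⟨Set.Finite.of_finite_image (Set.toFinite _) hinj, ?_⟩
  rw [← Set.ncard_image_of_injOn hinj]
  apply le_csSup
  · refine ⟨Fintype.card V, ?_⟩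
    rintro n ⟨s, hs⟩
    rw [← hs.card_eq]
    exact Finset.card_le_univ s
  · refine ⟨(Set.toFinite (Sigma.fst '' A)).toFinset, ?_, ?_⟩
    · rw [Set.Finite.coe_toFinset]
      rintro _ ⟨s, hs, rfl⟩ _ ⟨t, ht, rfl⟩ h
      exact hA s hs t ht (fun e => h (by rw [e]))
    · rw [Set.ncard_eq_toFinset_card _ (Set.toFinite _)]

end Aux

section Statements

variable {V : Type} [Fintype V] (Γ : SimpleGraph V) (G : V → Type) [∀ v, Group (G v)]

theorem stmt5 (g : GraphProduct Γ G) (d : ℕ) :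
    (dTail Γ G g d).Finite ∧ (dTail Γ G g d).ncard ≤ d * kappa Γ := by
  induction d with
  | zero =>
    have : dTail Γ G g 0 = ∅ := by
      ext s
      simp [dTail]
    simp [this]
  | succ d ih =>
    obtain ⟨h1, h2⟩ := gp_step Γ G (dTail Γ G g (d + 1) \ dTail Γ G g d)
      (fun s hs t ht hst => gp_tail_adj Γ G hs ht hst)
    have hsub : dTail Γ G g (d + 1) ⊆
        (dTail Γ G g (d + 1) \ dTail Γ G g d) ∪ dTail Γ G g d := by
      intro s hs
      by_cases h : s ∈ dTail Γ G g d
      · exact Or.inr h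
      · exact Or.inl ⟨hs, h⟩
    refine ⟨(h1.union ih.1).subset hsub, ?_⟩
    have h3 := Set.ncard_le_ncard hsub (h1.union ih.1)
    have h4 := Set.ncard_union_le (dTail Γ G g (d + 1) \ dTail Γ G g d) (dTail Γ G g d)
    have h5 := ih.2
    rw [Nat.succ_mul]
    omega

end Statements
end

section
/- Any set of mutually crossing walls of 𝕎 has cardinality at most κ, the maximal number of mutually adjacent vertices of Γ. -/
open scoped ComplexOrder
open scoped commutatorElement

section Helpers

set_option linter.unusedSectionVars false

open Classical

namespace GP

variable {V : Type} (Γ : SimpleGraph V) {G : V → Type} [∀ v, Group (G v)]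

noncomputable def hd (v : V) : List ((v : V) × G v) → G v
  | [] => 1
  | s :: w => if h : s.1 = v then h ▸ s.2 else if Γ.Adj s.1 v then hd v w else 1

noncomputable def tl (v : V) : List ((v : V) × G v) → List ((v : V) × G v)
  | [] => []
  | s :: w => if s.1 = v then w else if Γ.Adj s.1 v then s :: tl v w else s :: w

noncomputable def cons' (v : V) (x : G v) (w : List ((v : V) × G v)) : List ((v : V) × G v) :=
  if x = 1 then w else ⟨v, x⟩ :: w

noncomputable def act (v : V) (g : G v) (w : List ((v : V) × G v)) : List ((v : V) × G v) :=
  cons' v (g * hd Γ v w) (tl Γ v w)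

def Red : List ((v : V) × G v) → Prop
  | [] => True
  | s :: w => s.2 ≠ 1 ∧ hd Γ s.1 w = 1 ∧ Red w

inductive Sh : List ((v : V) × G v) → List ((v : V) × G v) → Prop
  | refl (w) : Sh w w
  | swap (s t : (v : V) × G v) (w) : Γ.Adj s.1 t.1 → Sh (s :: t :: w) (t :: s :: w)
  | cons (s) {w w'} : Sh w w' → Sh (s :: w) (s :: w')
  | trans {a b c} : Sh a b → Sh b c → Sh a c

variable {Γ}

lemma Sh.symm {w w' : List ((v : V) × G v)} (h : Sh Γ w w') : Sh Γ w' w := by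
  induction h with
  | refl w => exact .refl _
  | swap s t w h => exact .swap _ _ _ h.symm
  | cons s _ ih => exact .cons _ ih
  | trans _ _ i1 i2 => exact .trans i2 i1

@[simp] lemma hd_nil (v : V) : hd Γ v ([] : List ((v : V) × G v)) = 1 := rfl
@[simp] lemma tl_nil (v : V) : tl Γ v ([] : List ((v : V) × G v)) = [] := rfl

lemma hd_self (v : V) (x : G v) (w) : hd Γ v (⟨v, x⟩ :: w) = x := by simp [hd]
lemma tl_self (s : (v : V) × G v) (w) : tl Γ s.1 (s :: w) = w := by simp [tl]
lemma hd_self' (s : (v : V) × G v) (w) : hd Γ s.1 (s :: w) = s.2 := by simp [hd]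
lemma hd_adj {v : V} {s : (v : V) × G v} (h : Γ.Adj s.1 v) (w) :
    hd Γ v (s :: w) = hd Γ v w := by simp [hd, h, h.ne]
lemma tl_adj {v : V} {s : (v : V) × G v} (h : Γ.Adj s.1 v) (w) :
    tl Γ v (s :: w) = s :: tl Γ v w := by simp [tl, h, h.ne]
lemma hd_non {v : V} {s : (v : V) × G v} (h : ¬ Γ.Adj s.1 v) (h' : s.1 ≠ v) (w) :
    hd Γ v (s :: w) = 1 := by simp [hd, h, h']
lemma tl_non {v : V} {s : (v : V) × G v} (h : ¬ Γ.Adj s.1 v) (h' : s.1 ≠ v) (w) :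
    tl Γ v (s :: w) = s :: w := by simp [tl, h, h']

lemma tri (Γ : SimpleGraph V) (u v : V) : u = v ∨ Γ.Adj u v ∨ (¬ Γ.Adj u v ∧ u ≠ v) := by tauto

lemma Sh.hd_eq {w w' : List ((v : V) × G v)} (h : Sh Γ w w') (v : V) :
    hd Γ v w = hd Γ v w' := by
  induction h with
  | refl w => rfl
  | swap s t w h =>
    rcases tri Γ s.1 v with rfl | h1 | ⟨h1, h1'⟩
    · rw [hd_self', hd_adj h.symm, hd_self']
    · rcases tri Γ t.1 v with rfl | h2 | ⟨h2, h2'⟩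
      · rw [hd_self', hd_adj h1, hd_self']
      · rw [hd_adj h1, hd_adj h2, hd_adj h2, hd_adj h1]
      · rw [hd_adj h1, hd_non h2 h2', hd_non h2 h2']
    · rw [hd_non h1 h1']
      rcases tri Γ t.1 v with rfl | h2 | ⟨h2, h2'⟩
      · exact absurd h h1
      · rw [hd_adj h2, hd_non h1 h1']
      · rw [hd_non h2 h2']
  | cons s _ ih => simp only [hd, ih]
  | trans _ _ i1 i2 => exact i1.trans i2

lemma Sh.tl_sh {w w' : List ((v : V) × G v)} (h : Sh Γ w w') (v : V) :
    Sh Γ (tl Γ v w) (tl Γ v w') := by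
  induction h with
  | refl w => exact .refl _
  | swap s t w h =>
    rcases tri Γ s.1 v with rfl | h1 | ⟨h1, h1'⟩
    · rw [tl_self, tl_adj h.symm, tl_self]; exact .refl _
    · rcases tri Γ t.1 v with rfl | h2 | ⟨h2, h2'⟩
      · rw [tl_self, tl_adj h1, tl_self]; exact .refl _
      · rw [tl_adj h1, tl_adj h2, tl_adj h2, tl_adj h1]; exact .swap _ _ _ h
      · rw [tl_adj h1, tl_non h2 h2', tl_non h2 h2']; exact .swap _ _ _ h
    · rw [tl_non h1 h1']
      rcases tri Γ t.1 v with rfl | h2 | ⟨h2, h2'⟩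
      · exact absurd h h1
      · rw [tl_adj h2, tl_non h1 h1']; exact .swap _ _ _ h
      · rw [tl_non h2 h2']; exact .swap _ _ _ h
  | cons s h ih =>
    simp only [tl]
    split_ifs
    · exact h
    · exact .cons _ ih
    · exact .cons _ h
  | trans _ _ i1 i2 => exact i1.trans i2

lemma Sh.red {w w' : List ((v : V) × G v)} (h : Sh Γ w w') : Red Γ w → Red Γ w' := by
  induction h with
  | refl w => exact id
  | swap s t w h =>
    rintro ⟨a, b, c, d, e⟩
    rw [hd_adj h.symm] at b
    refine ⟨c, ?_, a, b, e⟩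
    rw [hd_adj h, d]
  | cons s h ih =>
    rintro ⟨a, b, c⟩
    exact ⟨a, by rw [← h.hd_eq, b], ih c⟩
  | trans _ _ i1 i2 => exact fun h => i2 (i1 h)

lemma Sh.len {w w' : List ((v : V) × G v)} (h : Sh Γ w w') : w.length = w'.length := by
  induction h with
  | refl w => rfl
  | swap s t w h => simp
  | cons s h ih => simp [ih]
  | trans _ _ i1 i2 => exact i1.trans i2

lemma ofSyl_comm {s t : (v : V) × G v} (h : Γ.Adj s.1 t.1) :
    ofSyl Γ G s * ofSyl Γ G t = ofSyl Γ G t * ofSyl Γ G s := by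
  rw [← commutatorElement_eq_one_iff_mul_comm]
  have : (⁅Monoid.CoprodI.of s.2, Monoid.CoprodI.of t.2⁆ : Monoid.CoprodI G) ∈
      Subgroup.normalClosure (commRels Γ G) :=
    Subgroup.subset_normalClosure ⟨s.1, t.1, s.2, t.2, h, rfl⟩
  exact (QuotientGroup.eq_one_iff _).2 this

lemma ofSyl_mul (v : V) (a b : G v) :
    ofSyl Γ G ⟨v, a * b⟩ = ofSyl Γ G ⟨v, a⟩ * ofSyl Γ G ⟨v, b⟩ := by
  simp [ofSyl]

lemma ofSyl_one (v : V) : ofSyl Γ G ⟨v, 1⟩ = 1 := by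
  simp [ofSyl]

@[simp] lemma wordProd_cons (s : (v : V) × G v) (w) :
    wordProd Γ G (s :: w) = ofSyl Γ G s * wordProd Γ G w := by simp [wordProd]
@[simp] lemma wordProd_nil : wordProd Γ G [] = 1 := by simp [wordProd]
@[simp] lemma wordProd_append (k w : List ((v : V) × G v)) :
    wordProd Γ G (k ++ w) = wordProd Γ G k * wordProd Γ G w := by simp [wordProd]

lemma Sh.prod {w w' : List ((v : V) × G v)} (h : Sh Γ w w') :
    wordProd Γ G w = wordProd Γ G w' := by
  induction h with
  | refl w => rfl
  | swap s t w h => simp only [wordProd_cons, ← mul_assoc, ofSyl_comm h]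
  | cons s h ih => simp [ih]
  | trans _ _ i1 i2 => exact i1.trans i2

lemma cons'_prod (v : V) (x : G v) (w) :
    wordProd Γ G (cons' v x w) = ofSyl Γ G ⟨v, x⟩ * wordProd Γ G w := by
  unfold cons'
  split_ifs with h
  · subst h; simp [ofSyl_one]
  · simp

lemma tl_eq {v : V} {w : List ((v : V) × G v)} (hw : Red Γ w) (h : hd Γ v w = 1) :
    tl Γ v w = w := by
  induction w with
  | nil => rfl
  | cons s w ih =>
    rcases tri Γ s.1 v with rfl | h1 | ⟨h1, h1'⟩
    · rw [hd_self'] at h; exact absurd h hw.1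
    · rw [hd_adj h1] at h
      rw [tl_adj h1, ih hw.2.2 h]
    · rw [tl_non h1 h1']

lemma sh_cons {v : V} {w : List ((v : V) × G v)} (hw : Red Γ w) :
    Sh Γ w (cons' v (hd Γ v w) (tl Γ v w)) := by
  induction w with
  | nil => simp [cons']; exact .refl _
  | cons s w ih =>
    rcases tri Γ s.1 v with rfl | h1 | ⟨h1, h1'⟩
    · rw [hd_self', tl_self, cons', if_neg hw.1]; exact .refl _
    · have := ih hw.2.2
      rw [hd_adj h1, tl_adj h1]
      by_cases h : hd Γ v w = 1
      · rw [tl_eq hw.2.2 h, h, cons', if_pos rfl]; exact .refl _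
      · rw [cons', if_neg h] at this ⊢
        exact (Sh.cons s this).trans (.swap _ _ _ h1)
    · rw [tl_non h1 h1', hd_non h1 h1', cons', if_pos rfl]; exact .refl _

lemma hd_tl {u v : V} (h : Γ.Adj u v) (w : List ((v : V) × G v)) :
    hd Γ u (tl Γ v w) = hd Γ u w := by
  induction w with
  | nil => rfl
  | cons s w ih =>
    rcases tri Γ s.1 v with rfl | h1 | ⟨h1, h1'⟩
    · rw [tl_self, hd_adj h.symm]
    · rw [tl_adj h1]; simp only [hd, ih]
    · rw [tl_non h1 h1']

lemma red_tl (v : V) {w : List ((v : V) × G v)} (hw : Red Γ w) :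
    Red Γ (tl Γ v w) ∧ hd Γ v (tl Γ v w) = 1 := by
  induction w with
  | nil => exact ⟨trivial, rfl⟩
  | cons s w ih =>
    rcases tri Γ s.1 v with rfl | h1 | ⟨h1, h1'⟩
    · rw [tl_self]; exact ⟨hw.2.2, hw.2.1⟩
    · rw [tl_adj h1, hd_adj h1]
      exact ⟨⟨hw.1, by rw [hd_tl h1]; exact hw.2.1, (ih hw.2.2).1⟩, (ih hw.2.2).2⟩
    · rw [tl_non h1 h1']; exact ⟨hw, hd_non h1 h1' _⟩

lemma red_cons' {v : V} {x : G v} {w : List ((v : V) × G v)} (hw : Red Γ w)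
    (h : hd Γ v w = 1) : Red Γ (cons' v x w) := by
  unfold cons'
  split_ifs with hx
  · exact hw
  · exact ⟨hx, h, hw⟩

lemma red_act (v : V) (g : G v) {w : List ((v : V) × G v)} (hw : Red Γ w) :
    Red Γ (act Γ v g w) := red_cons' (red_tl v hw).1 (red_tl v hw).2

lemma hd_cons' {v : V} {x : G v} {w : List ((v : V) × G v)} 
    (h : hd Γ v w = 1) : hd Γ v (cons' v x w) = x := by
  unfold cons'
  split_ifs with hx
  · rw [h, hx]
  · rw [hd_self]

lemma tl_cons' {v : V} {x : G v} {w : List ((v : V) × G v)} (hw : Red Γ w)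
    (h : hd Γ v w = 1) : tl Γ v (cons' v x w) = w := by
  unfold cons'
  split_ifs with hx
  · exact tl_eq hw h
  · exact tl_self (⟨v, x⟩ : (v : V) × G v) w

lemma hd_act (v : V) (g : G v) {w : List ((v : V) × G v)} (hw : Red Γ w) :
    hd Γ v (act Γ v g w) = g * hd Γ v w := hd_cons' (red_tl v hw).2

lemma act_act (v : V) (g h : G v) {w : List ((v : V) × G v)} (hw : Red Γ w) :
    act Γ v g (act Γ v h w) = act Γ v (g * h) w := by
  rw [act, hd_act v h hw]
  conv_lhs => rw [act, tl_cons' (red_tl v hw).1 (red_tl v hw).2]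
  rw [act, mul_assoc]

lemma act_one (v : V) {w : List ((v : V) × G v)} (hw : Red Γ w) :
    Sh Γ (act Γ v 1 w) w := by
  rw [act, one_mul]; exact (sh_cons hw).symm

lemma sh_cons' {v : V} (x : G v) {w w' : List ((v : V) × G v)} (h : Sh Γ w w') :
    Sh Γ (cons' v x w) (cons' v x w') := by
  unfold cons'
  split_ifs
  · exact h
  · exact .cons _ h

lemma sh_act {v : V} (x : G v) {w w' : List ((v : V) × G v)} (h : Sh Γ w w') :
    Sh Γ (act Γ v x w) (act Γ v x w') := by
  rw [act, act, h.hd_eq]; exact sh_cons' _ (h.tl_sh v)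

lemma hd_cons'_adj {u v : V} (h : Γ.Adj u v) (x : G u) (w : List ((v : V) × G v)) :
    hd Γ v (cons' u x w) = hd Γ v w := by
  unfold cons'
  split_ifs
  · rfl
  · exact hd_adj (s := ⟨u, x⟩) h w

lemma tl_cons'_adj {u v : V} (h : Γ.Adj u v) (x : G u) (w : List ((v : V) × G v)) :
    tl Γ v (cons' u x w) = cons' u x (tl Γ v w) := by
  unfold cons'
  split_ifs
  · rfl
  · exact tl_adj (s := ⟨u, x⟩) h w

lemma tl_tl {u v : V} (h : Γ.Adj u v) (w : List ((v : V) × G v)) :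
    tl Γ u (tl Γ v w) = tl Γ v (tl Γ u w) := by
  induction w with
  | nil => rfl
  | cons s w ih =>
    rcases tri Γ s.1 v with rfl | h1 | ⟨h1, h1'⟩
    · rw [tl_self, tl_adj h.symm, tl_self]
    · rw [tl_adj h1]
      rcases tri Γ s.1 u with rfl | h2 | ⟨h2, h2'⟩
      · rw [tl_self, tl_self]
      · rw [tl_adj h2, tl_adj h2, tl_adj h1, ih]
      · rw [tl_non h2 h2', tl_non h2 h2', tl_adj h1]
    · rw [tl_non h1 h1']
      rcases tri Γ s.1 u with rfl | h2 | ⟨h2, h2'⟩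
      · exact absurd h h1
      · rw [tl_adj h2, tl_non h1 h1']
      · rw [tl_non h2 h2', tl_non h1 h1']

lemma act_comm {u v : V} (h : Γ.Adj u v) (x : G u) (y : G v) (w : List ((v : V) × G v)) :
    Sh Γ (act Γ u x (act Γ v y w)) (act Γ v y (act Γ u x w)) := by
  simp only [act, hd_cons'_adj h, hd_cons'_adj h.symm, tl_cons'_adj h, tl_cons'_adj h.symm,
    hd_tl h, hd_tl h.symm, tl_tl h]
  generalize x * _ = a
  generalize y * _ = b
  unfold cons'
  split_ifs
  · exact .refl _
  · exact .refl _
  · exact .refl _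
  · exact .swap _ _ _ h

lemma act_prod (v : V) (g : G v) {w : List ((v : V) × G v)} (hw : Red Γ w) :
    wordProd Γ G (act Γ v g w) = ofSyl Γ G ⟨v, g⟩ * wordProd Γ G w := by
  rw [act, cons'_prod, ofSyl_mul, mul_assoc, ← cons'_prod, ← (sh_cons hw).prod]

variable (Γ G) in
def stp : Setoid {w : List ((v : V) × G v) // Red Γ w} where
  r a b := Sh Γ a.1 b.1
  iseqv := ⟨fun _ => .refl _, fun h => h.symm, fun h h' => h.trans h'⟩

variable (Γ G) in
abbrev Q := Quotient (stp Γ G)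

variable (Γ G) in
noncomputable def qact (v : V) (g : G v) : Q Γ G → Q Γ G :=
  Quotient.map (fun w => ⟨act Γ v g w.1, red_act v g w.2⟩) (fun _ _ h => sh_act g h)

variable (Γ G) in
noncomputable def vhom (v : V) : G v →* Equiv.Perm (Q Γ G) :=
  MonoidHom.toHomPerm
    { toFun := fun g => (qact Γ G v g : Function.End (Q Γ G))
      map_one' := by
        funext q
        induction q using Quotient.inductionOn with | _ w =>
        exact Quotient.sound (act_one v w.2)
      map_mul' := fun g h => by
        funext q
        induction q using Quotient.inductionOn with | _ w =>
        refine Quotient.sound (?_ : Sh Γ _ _)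
        simp only [act_act v g h w.2]
        exact .refl _ }

variable (Γ G) in
noncomputable def ghom : GraphProduct Γ G →* Equiv.Perm (Q Γ G) :=
  QuotientGroup.lift _ (Monoid.CoprodI.lift (vhom Γ G)) (by
    have : Subgroup.normalClosure (commRels Γ G) ≤ (Monoid.CoprodI.lift (vhom Γ G)).ker := by
      apply Subgroup.normalClosure_le_normal
      rintro _ ⟨v, w, a, b, h, rfl⟩
      rw [SetLike.mem_coe, MonoidHom.mem_ker, map_commutatorElement,
        commutatorElement_eq_one_iff_mul_comm]
      simp only [Monoid.CoprodI.lift_of]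
      ext q
      induction q using Quotient.inductionOn with | _ z =>
      exact Quotient.sound (act_comm h a b z.1)
    exact fun x hx => this hx)

lemma ghom_syl (s : (v : V) × G v) (q : Q Γ G) : ghom Γ G (ofSyl Γ G s) q = qact Γ G s.1 s.2 q := by
  have : ghom Γ G (ofSyl Γ G s) = vhom Γ G s.1 s.2 := by
    unfold ghom ofSyl
    erw [QuotientGroup.lift_mk]
  rw [this]; rfl

lemma ghom_red {w : List ((v : V) × G v)} (hw : Red Γ w) :
    ghom Γ G (wordProd Γ G w) (Quotient.mk (stp Γ G) ⟨[], trivial⟩) =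
      Quotient.mk (stp Γ G) ⟨w, hw⟩ := by
  induction w with
  | nil => simp
  | cons s w ih =>
    rw [wordProd_cons, map_mul, Equiv.Perm.mul_apply, ih hw.2.2, ghom_syl]
    refine Quotient.sound (?_ : Sh Γ _ _)
    simp only [act, hw.2.1, tl_eq hw.2.2 hw.2.1, mul_one, cons', if_neg hw.1]
    exact .refl _

theorem red_unique {w w' : List ((v : V) × G v)} (hw : Red Γ w) (hw' : Red Γ w')
    (h : wordProd Γ G w = wordProd Γ G w') : Sh Γ w w' := by
  have h1 := ghom_red hw
  rw [h, ghom_red hw'] at h1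
  exact (Quotient.exact h1).symm

lemma tl_len (v : V) (w : List ((v : V) × G v)) : (tl Γ v w).length ≤ w.length := by
  induction w with
  | nil => simp
  | cons s w ih =>
    simp only [tl]; split_ifs <;> simp [ih]

lemma exists_red (w : List ((v : V) × G v)) : ∃ w', Red Γ w' ∧ w'.length ≤ w.length ∧
    wordProd Γ G w' = wordProd Γ G w := by
  induction w with
  | nil => exact ⟨[], trivial, le_rfl, rfl⟩
  | cons s w ih =>
    obtain ⟨w', h1, h2, h3⟩ := ih
    refine ⟨act Γ s.1 s.2 w', red_act _ _ h1, ?_, ?_⟩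
    · have := tl_len (Γ := Γ) s.1 w'
      rw [act, cons']; split_ifs <;> simp <;> omega
    · rw [act_prod _ _ h1, h3, wordProd_cons]

lemma exists_word (g : GraphProduct Γ G) : ∃ w, wordProd Γ G w = g := by
  induction g using QuotientGroup.induction_on with | _ z =>
  induction z using Monoid.CoprodI.induction_on with
  | one => exact ⟨[], by simp⟩
  | of i m => exact ⟨[⟨i, m⟩], by simp [ofSyl]⟩
  | mul x y hx hy =>
    obtain ⟨a, ha⟩ := hx
    obtain ⟨b, hb⟩ := hy
    exact ⟨a ++ b, by simp [ha, hb]⟩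

lemma exists_redword (g : GraphProduct Γ G) : ∃ w, Red Γ w ∧ wordProd Γ G w = g := by
  obtain ⟨w, rfl⟩ := exists_word g
  obtain ⟨w', h, _, h'⟩ := exists_red (Γ := Γ) w
  exact ⟨w', h, h'⟩

lemma red_ne {w : List ((v : V) × G v)} (hw : Red Γ w) : ∀ s ∈ w, s.2 ≠ 1 := by
  induction w with
  | nil => simp
  | cons s w ih =>
    intro t ht
    rcases List.mem_cons.1 ht with rfl | ht
    · exact hw.1
    · exact ih hw.2.2 t ht

lemma redLength_eq {w : List ((v : V) × G v)} (hw : Red Γ w) :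
    redLength Γ G (wordProd Γ G w) = w.length := by
  apply le_antisymm
  · exact Nat.sInf_le ⟨w, ⟨red_ne hw, rfl⟩, rfl⟩
  · refine le_csInf ⟨w.length, w, ⟨red_ne hw, rfl⟩, rfl⟩ ?_
    rintro _ ⟨w', ⟨_, h⟩, rfl⟩
    obtain ⟨w2, h1, h2, h3⟩ := exists_red (Γ := Γ) w'
    rw [(red_unique hw h1 (by rw [h3, h])).len]
    exact h2

variable (Γ) in
noncomputable def pi (v : V) (g : GraphProduct Γ G) : G v :=
  hd Γ v (exists_redword g).choose

lemma pi_eq (v : V) {w : List ((v : V) × G v)} (hw : Red Γ w) :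
    pi Γ v (wordProd Γ G w) = hd Γ v w :=
  (red_unique (exists_redword _).choose_spec.1 hw (exists_redword _).choose_spec.2).hd_eq v

lemma mem_halfSpace (v : V) (g : GraphProduct Γ G) : g ∈ halfSpace Γ G v ↔ pi Γ v g ≠ 1 := by
  obtain ⟨w, hw, rfl⟩ := exists_redword g
  rw [pi_eq v hw]
  have hl := (sh_cons (v := v) hw).len
  constructor
  · rintro ⟨x, hx⟩ h
    rw [← act_prod v x hw, redLength_eq hw, redLength_eq (red_act v x hw), act, h,
      tl_eq hw h, cons'] at hx
    split_ifs at hx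
    · omega
    · simp at hx
  · intro h
    refine ⟨(hd Γ v w)⁻¹, ?_⟩
    rw [← act_prod v _ hw, redLength_eq hw, redLength_eq (red_act v _ hw), act, cons',
      if_pos (by simp), hl, cons', if_neg h]
    simp

lemma pi_syl {v : V} (s : (v : V) × G v) (h : s.1 = v ∨ Γ.Adj s.1 v) :
    ∃ c : G v, ∀ g, pi Γ v (ofSyl Γ G s * g) = c * pi Γ v g := by
  rcases h with rfl | h
  · refine ⟨s.2, fun g => ?_⟩
    obtain ⟨w, hw, rfl⟩ := exists_redword g
    rw [← act_prod s.1 s.2 hw, pi_eq _ hw, pi_eq _ (red_act _ _ hw), hd_act _ _ hw]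
  · refine ⟨1, fun g => ?_⟩
    obtain ⟨w, hw, rfl⟩ := exists_redword g
    rw [← act_prod s.1 s.2 hw, pi_eq _ hw, pi_eq _ (red_act _ _ hw), act, hd_cons'_adj h,
      hd_tl h.symm, one_mul]

lemma hd_append (u : V) (a : G u) {k w : List ((v : V) × G v)} (hk : Red Γ k) (h1 : hd Γ u k = 1)
    (h2 : hd Γ u (k ++ w) ≠ 1) :
    hd Γ u w ≠ 1 ∧ ofSyl Γ G ⟨u, a⟩ * wordProd Γ G k = wordProd Γ G k * ofSyl Γ G ⟨u, a⟩ := by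
  induction k with
  | nil => simpa using h2
  | cons s k ih =>
    rw [List.cons_append] at h2
    rcases tri Γ s.1 u with rfl | h | ⟨h, h'⟩
    · rw [hd_self'] at h1; exact absurd h1 hk.1
    · rw [hd_adj h] at h1 h2
      obtain ⟨i1, i2⟩ := ih hk.2.2 h1 h2
      refine ⟨i1, ?_⟩
      have := ofSyl_comm (Γ := Γ) (s := s) (t := ⟨u, a⟩) h
      rw [wordProd_cons, ← mul_assoc, ← this, mul_assoc, i2, mul_assoc]
    · exact absurd (hd_non h h' _) h2

lemma concat {k w : List ((v : V) × G v)} (hk : Red Γ k) (hw : Red Γ w) :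
    Red Γ (k ++ w) ∨ ∃ s : (v : V) × G v, ∃ k2, hd Γ s.1 w ≠ 1 ∧ k2.length < k.length ∧
      wordProd Γ G k = wordProd Γ G k2 * ofSyl Γ G s := by
  induction k with
  | nil => exact .inl hw
  | cons s k ih =>
    rcases ih hk.2.2 with h | ⟨t, k2, h1, h2, h3⟩
    · by_cases h' : hd Γ s.1 (k ++ w) = 1
      · exact .inl ⟨hk.1, h', h⟩
      · obtain ⟨i1, i2⟩ := hd_append s.1 s.2 hk.2.2 hk.2.1 h'
        exact .inr ⟨s, k, i1, by simp, by rw [wordProd_cons]; exact i2⟩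
    · refine .inr ⟨t, s :: k2, h1, by simpa using h2, ?_⟩
      rw [wordProd_cons, h3, wordProd_cons, mul_assoc]

lemma hd_both {u v : V} {w : List ((v : V) × G v)} (hu : hd Γ u w ≠ 1) (hv : hd Γ v w ≠ 1) :
    u = v ∨ Γ.Adj u v := by
  induction w with
  | nil => simp at hu
  | cons s w ih =>
    rcases tri Γ s.1 u with rfl | h | ⟨h, h'⟩
    · rcases tri Γ s.1 v with h | h | ⟨h, h'⟩
      · exact .inl h
      · exact .inr h
      · exact absurd (hd_non h h' _) hv
    · rcases tri Γ s.1 v with rfl | h2 | ⟨h2, h2'⟩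
      · exact .inr h.symm
      · rw [hd_adj h] at hu; rw [hd_adj h2] at hv; exact ih hu hv
      · exact absurd (hd_non h2 h2' _) hv
    · exact absurd (hd_non h h' _) hu

variable (Γ G) in
def R (v w : V) (k : GraphProduct Γ G) : Prop :=
  (∃ (x : G v) (y : G w), ∀ g, pi Γ v g ≠ x → pi Γ w (k * g) = y) ∨
  ∃ f : G v → G w, ∀ g, pi Γ w (k * g) = f (pi Γ v g)

lemma R_left {v w : V} {k s : GraphProduct Γ G} (c : G w)
    (hc : ∀ g, pi Γ w (s * g) = c * pi Γ w g) (h : R Γ G v w k) : R Γ G v w (s * k) := by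
  rcases h with ⟨x, y, h⟩ | ⟨f, h⟩
  · exact .inl ⟨x, c * y, fun g hg => by rw [mul_assoc, hc, h g hg]⟩
  · exact .inr ⟨fun x => c * f x, fun g => by rw [mul_assoc, hc, h]⟩

lemma R_right {v w : V} {k s : GraphProduct Γ G} (c : G v)
    (hc : ∀ g, pi Γ v (s * g) = c * pi Γ v g) (h : R Γ G v w k) : R Γ G v w (k * s) := by
  rcases h with ⟨x, y, h⟩ | ⟨f, h⟩
  · refine .inl ⟨c⁻¹ * x, y, fun g hg => ?_⟩
    rw [mul_assoc, h]
    rw [hc]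
    rintro rfl
    simp at hg
  · exact .inr ⟨fun x => f (c * x), fun g => by rw [mul_assoc, h, hc]⟩

lemma R_all {v w : V} (hvw : ¬ Γ.Adj v w) (n : ℕ) :
    ∀ k : List ((v : V) × G v), k.length ≤ n → R Γ G v w (wordProd Γ G k) := by
  induction n using Nat.strong_induction_on with | _ n IH =>
  intro k0 hk0
  obtain ⟨k, hk, hl, he⟩ := exists_red (Γ := Γ) k0
  rw [← he]
  have IH' : ∀ k' : List ((v : V) × G v), k'.length < k.length → R Γ G v w (wordProd Γ G k') :=
    fun k' h => IH k'.length (by omega) k' le_rfl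
  by_cases hA : ∃ s : (v : V) × G v, ∃ k2, (s.1 = v ∨ Γ.Adj s.1 v) ∧ k2.length < k.length ∧
      wordProd Γ G k = wordProd Γ G k2 * ofSyl Γ G s
  · obtain ⟨s, k2, h1, h2, h3⟩ := hA
    obtain ⟨c, hc⟩ := pi_syl s h1
    rw [h3]
    exact R_right c hc (IH' k2 h2)
  have hB : ∀ z, Red Γ z → hd Γ v z ≠ 1 → Red Γ (k ++ z) := by
    intro z hz hvz
    rcases concat hk hz with h | ⟨s, k2, h1, h2, h3⟩
    · exact h
    · exact absurd ⟨s, k2, hd_both h1 hvz, h2, h3⟩ hA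
  rcases k with _ | ⟨s, k⟩
  · by_cases h : v = w
    · subst h
      exact .inr ⟨id, fun g => by simp⟩
    · refine .inl ⟨1, 1, fun g hg => ?_⟩
      obtain ⟨z, hz, rfl⟩ := exists_redword g
      rw [pi_eq _ hz] at hg
      rw [wordProd_nil, one_mul, pi_eq _ hz]
      by_contra h'
      rcases hd_both hg h' with h'' | h''
      · exact h h''
      · exact hvw h''
  · by_cases h : s.1 = w ∨ Γ.Adj s.1 w
    · obtain ⟨c, hc⟩ := pi_syl s h
      rw [wordProd_cons]
      exact R_left c hc (IH' k (by simp))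
    · push Not at h
      refine .inl ⟨1, 1, fun g hg => ?_⟩
      obtain ⟨z, hz, rfl⟩ := exists_redword g
      rw [pi_eq _ hz] at hg
      rw [← wordProd_append, pi_eq _ (hB z hz hg), List.cons_append, hd_non h.2 h.1]

lemma cross_adj {v w : V} {k h : GraphProduct Γ G}
    (hc : Cross (wallTrans Γ G k (halfSpace Γ G v)) (wallTrans Γ G h (halfSpace Γ G w))) :
    Γ.Adj v w := by
  by_contra hvw
  have hm : ∀ (u : V) (l x : GraphProduct Γ G),
      x ∈ wallTrans Γ G l (halfSpace Γ G u) ↔ pi Γ u (l⁻¹ * x) ≠ 1 := by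
    intro u l x
    rw [← mem_halfSpace, wallTrans]
    constructor
    · rintro ⟨y, hy, rfl⟩; simpa using hy
    · intro hy; exact ⟨_, hy, by simp⟩
  have hR : R Γ G v w (h⁻¹ * k) := by
    obtain ⟨z, hz⟩ := exists_word (h⁻¹ * k)
    rw [← hz]; exact R_all hvw _ z le_rfl
  have hg : ∀ x, h⁻¹ * k * (k⁻¹ * x) = h⁻¹ * x := fun x => by group
  obtain ⟨⟨a, ha, ha'⟩, ⟨b, hb, hb'⟩, ⟨c, hc, hc'⟩, ⟨d, hd, hd'⟩⟩ := hc
  simp only [Set.mem_compl_iff, hm, not_not] at ha ha' hb hb' hc hc' hd hd'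
  have key : ∀ f : G w, (∀ x, pi Γ v (k⁻¹ * x) = 1 → pi Γ w (h⁻¹ * x) = f) → False := by
    intro f hf
    exact hc' ((hf c hc).trans ((hf d hd).symm.trans hd'))
  rcases hR with ⟨x, y, hxy⟩ | ⟨f, hf⟩
  · have hxy' : ∀ z, pi Γ v (k⁻¹ * z) ≠ x → pi Γ w (h⁻¹ * z) = y := fun z hz => by
      rw [← hg]; exact hxy _ hz
    by_cases hx : x = 1
    · subst hx
      exact ha' ((hxy' a ha).trans ((hxy' b hb).symm.trans hb'))
    · exact key y fun z hz => hxy' z (by rw [hz]; exact Ne.symm hx)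
  · exact key (f 1) fun z hz => by rw [← hg, hf, hz]

end GP

end Helpers

section Statements

variable {V : Type} [Fintype V] (Γ : SimpleGraph V) (G : V → Type) [∀ v, Group (G v)]

theorem stmt9 (W : Set (Set (GraphProduct Γ G)))
    (hW : W ⊆ Walls Γ G) (hcross : W.Pairwise Cross) :
    W.Finite ∧ W.ncard ≤ kappa Γ := by
  classical
  have hW' : ∀ s : W, ∃ (v : V) (k : GraphProduct Γ G),
      s.1 = wallTrans Γ G k (halfSpace Γ G v) := fun s => by
    obtain ⟨k, v, h⟩ := hW s.2
    exact ⟨v, k, h⟩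
  choose f k hf using hW'
  have hadj : ∀ s t : W, s ≠ t → Γ.Adj (f s) (f t) := by
    intro s t hst
    have := hcross s.2 t.2 (fun h => hst (Subtype.ext h))
    rw [hf s, hf t] at this
    exact GP.cross_adj this
  have hinj : Function.Injective f := by
    intro s t h
    by_contra hst
    exact (hadj s t hst).ne h
  have hfin : Finite W := Finite.of_injective f hinj
  refine ⟨hfin, ?_⟩
  have := Fintype.ofFinite W
  refine le_csSup ⟨Fintype.card V, ?_⟩ ⟨Finset.univ.image f, ?_, ?_⟩
  · rintro n ⟨s, hs⟩
    rw [← hs.card_eq]; exact Finset.card_le_univ s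
  · intro a ha b hb hab
    simp only [Finset.coe_image, Finset.coe_univ, Set.image_univ, Set.mem_range] at ha hb
    obtain ⟨s, rfl⟩ := ha
    obtain ⟨t, rfl⟩ := hb
    exact hadj s t (fun h => hab (by rw [h]))
  · rw [Finset.card_image_of_injective _ hinj, Finset.card_univ, ← Nat.card_eq_fintype_card]
    rfl

end Statements
end
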